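/- For every bandwidth ratio τ > 0, the optimal type 2 error exponent satisfies lim_{ε→0} κ(τ,ε) = θ(τ). -/

import Mathlib

open Filter Real

noncomputable section

namespace DHT

/-- Real-valued indicator of a proposition. -/
def ind (P : Prop) : ℝ := by classical exact if P then 1 else 0

/-- `p` is a probability mass function on the finite type `α`. -/
def IsPMF {α : Type*} [Fintype α] (p : α → ℝ) : Prop :=
  (∀ a, 0 ≤ p a) ∧ ∑ a, p a = 1

/-- `f` is a stochastic kernel: every row is a pmf. -/
def IsKernel {α β : Type*} [Fintype β] (f : α → β → ℝ) : Prop :=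
  ∀ a, (∀ b, 0 ≤ f a b) ∧ ∑ b, f a b = 1

/-- Pushforward of a pmf along a map. -/
def pushf {α β : Type*} [Fintype α] (p : α → ℝ) (f : α → β) : β → ℝ :=
  fun b => ∑ a, ind (f a = b) * p a

/-- Probability of a set under a pmf. -/
def probIn {α : Type*} [Fintype α] (p : α → ℝ) (A : Set α) : ℝ :=
  ∑ a, ind (a ∈ A) * p a

/-- Shannon entropy, in bits. -/
def entropy {α : Type*} [Fintype α] (p : α → ℝ) : ℝ :=
  -∑ a, p a * Real.logb 2 (p a)

/-- Kullback–Leibler divergence, in bits. -/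
def klDiv {α : Type*} [Fintype α] (p q : α → ℝ) : ℝ :=
  ∑ a, p a * Real.logb 2 (p a / q a)

/-- Conditional entropy `H(α | β)` of a joint pmf on `α × β`, in bits. -/
def condEntropy {α β : Type*} [Fintype α] [Fintype β] (p : α × β → ℝ) : ℝ :=
  -∑ x : α × β, p x * Real.logb 2 (p x / ∑ a, p (a, x.2))

/-- Mutual information `I(α;β)`, in bits. -/
def mutualInfo {α β : Type*} [Fintype α] [Fintype β] (p : α × β → ℝ) : ℝ :=
  ∑ x : α × β, p x * Real.logb 2 (p x / ((∑ b, p (x.1, b)) * (∑ a, p (a, x.2))))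

/-- Conditional mutual information `I(α;β|γ)`, in bits. -/
def condMI {α β γ : Type*} [Fintype α] [Fintype β] [Fintype γ] (p : α × β × γ → ℝ) : ℝ :=
  ∑ x : α × β × γ, p x * Real.logb 2
    (p x * (∑ a, ∑ b, p (a, b, x.2.2)) /
      ((∑ b, p (x.1, b, x.2.2)) * (∑ a, p (a, x.2.1, x.2.2))))

/-- Markov chain `α − β − γ`: the first and third components are conditionally
independent given the middle one. -/
def MarkovChain {α β γ : Type*} [Fintype α] [Fintype γ] (p : α × β × γ → ℝ) : Prop :=
  ∀ a b c, p (a, b, c) * (∑ a', ∑ c', p (a', b, c')) =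
    (∑ c', p (a, b, c')) * (∑ a', p (a', b, c))

/-- Shannon capacity of a discrete memoryless channel, in bits per use. -/
def capacity {X Y : Type*} [Fintype X] [Fintype Y] (Ch : X → Y → ℝ) : ℝ :=
  sSup {c | ∃ q : X → ℝ, IsPMF q ∧ c = mutualInfo (fun xy : X × Y => q xy.1 * Ch xy.1 xy.2)}

/-- Empirical distribution (type) of a length-`j` sequence. -/
def empDist {α : Type*} [Fintype α] {j : ℕ} (w : Fin j → α) : α → ℝ :=
  fun a => (∑ i, ind (w i = a)) / j

/-- δ-typicality: the empirical distribution is within δ of `p` in every coordinate. -/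
def IsTypical {α : Type*} [Fintype α] (p : α → ℝ) (δ : ℝ) {j : ℕ} (w : Fin j → α) : Prop :=
  ∀ a, |empDist w a - p a| ≤ δ

section System

variable {L : ℕ} {U X Y : Fin L → Type} {V Z : Type}
variable [∀ l, Fintype (U l)] [∀ l, Fintype (X l)] [∀ l, Fintype (Y l)]
variable [Fintype V] [Fintype Z]

/-- Joint pmf of the channel outputs `(Y₁ⁿ,…,Y_Lⁿ)`, `V^k` and `Z^k` induced by `k` i.i.d.
copies of the source `R`, the stochastic encoders `f` and the memoryless channels `Ch`. -/
def inducedDist (R : (((l : Fin L) → U l) × V × Z) → ℝ)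
    (Ch : (l : Fin L) → X l → Y l → ℝ) (k n : ℕ)
    (f : (l : Fin L) → (Fin k → U l) → (Fin n → X l) → ℝ) :
    (((l : Fin L) → Fin n → Y l) × (Fin k → V) × (Fin k → Z)) → ℝ :=
  fun yvz =>
    ∑ u : (l : Fin L) → Fin k → U l, ∑ x : (l : Fin L) → Fin n → X l,
      (∏ i : Fin k, R ((fun l => u l i), yvz.2.1 i, yvz.2.2 i)) *
        ((∏ l, f l (u l) (x l)) * ∏ l, ∏ j : Fin n, Ch l (x l j) (yvz.1 l j))

/-- `P` and `Q` have the same single-variable marginals. -/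
def SameMarginals (P Q : (((l : Fin L) → U l) × V × Z) → ℝ) : Prop :=
  (∀ (l : Fin L) (a : U l),
      (∑ x : ((l : Fin L) → U l) × V × Z, ind (x.1 l = a) * P x) =
        ∑ x : ((l : Fin L) → U l) × V × Z, ind (x.1 l = a) * Q x) ∧
  (∀ v : V, (∑ x : ((l : Fin L) → U l) × V × Z, ind (x.2.1 = v) * P x) =
      ∑ x : ((l : Fin L) → U l) × V × Z, ind (x.2.1 = v) * Q x) ∧
  (∀ z : Z, (∑ x : ((l : Fin L) → U l) × V × Z, ind (x.2.2 = z) * P x) =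
      ∑ x : ((l : Fin L) → U l) × V × Z, ind (x.2.2 = z) * Q x)

/-- Testing against conditional independence: `Q = P_{U_𝓛|Z} P_{V|Z} P_Z`. -/
def IsTACI (P Q : (((l : Fin L) → U l) × V × Z) → ℝ) : Prop :=
  ∀ x : ((l : Fin L) → U l) × V × Z,
    Q x = (∑ v : V, P (x.1, v, x.2.2)) * (∑ u : (l : Fin L) → U l, P (u, x.2.1, x.2.2)) /
      (∑ u : (l : Fin L) → U l, ∑ v : V, P (u, v, x.2.2))

/-- Optimal type-2 error probability `β(k,τ,ε)`. -/
def beta (P Q : (((l : Fin L) → U l) × V × Z) → ℝ)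
    (Ch : (l : Fin L) → X l → Y l → ℝ) (τ ε : ℝ) (k : ℕ) : ℝ :=
  sInf {b | ∃ n : ℕ, (n : ℝ) ≤ τ * k ∧
    ∃ f : (l : Fin L) → (Fin k → U l) → (Fin n → X l) → ℝ,
      (∀ l, IsKernel (f l)) ∧
      ∃ A : Set (((l : Fin L) → Fin n → Y l) × (Fin k → V) × (Fin k → Z)),
        probIn (inducedDist P Ch k n f) Aᶜ ≤ ε ∧
        b = probIn (inducedDist Q Ch k n f) A}

/-- `θ(k,τ)`. -/
def thetaK (P Q : (((l : Fin L) → U l) × V × Z) → ℝ)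
    (Ch : (l : Fin L) → X l → Y l → ℝ) (τ : ℝ) (k : ℕ) : ℝ :=
  sSup {d | ∃ n : ℕ, (n : ℝ) ≤ τ * k ∧
    ∃ f : (l : Fin L) → (Fin k → U l) → (Fin n → X l) → ℝ,
      (∀ l, IsKernel (f l)) ∧
      d = klDiv (inducedDist P Ch k n f) (inducedDist Q Ch k n f) / k}

/-- `θ(τ) = sup_{k ≥ 1} θ(k,τ)`. -/
def theta (P Q : (((l : Fin L) → U l) × V × Z) → ℝ)
    (Ch : (l : Fin L) → X l → Y l → ℝ) (τ : ℝ) : ℝ :=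
  sSup {d | ∃ k : ℕ, 1 ≤ k ∧ d = thetaK P Q Ch τ k}

/-- Optimal type-2 error exponent `κ(τ,ε)`. -/
def kappa (P Q : (((l : Fin L) → U l) × V × Z) → ℝ)
    (Ch : (l : Fin L) → X l → Y l → ℝ) (τ ε : ℝ) : ℝ :=
  sSup {κ : ℝ | 0 ≤ κ ∧ ∀ δ : ℝ, 0 < δ →
    Filter.limsup (fun k : ℕ => Real.logb 2 (beta P Q Ch τ ε k) / k) Filter.atTop ≤ -(κ - δ)}

/-- `I(V^k; Y₁ⁿ,…,Y_Lⁿ | Z^k)` of the induced distribution. -/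
def miVY (P : (((l : Fin L) → U l) × V × Z) → ℝ)
    (Ch : (l : Fin L) → X l → Y l → ℝ) (k n : ℕ)
    (f : (l : Fin L) → (Fin k → U l) → (Fin n → X l) → ℝ) : ℝ :=
  condMI (fun x : (Fin k → V) × ((l : Fin L) → Fin n → Y l) × (Fin k → Z) =>
    inducedDist P Ch k n f (x.2.1, x.1, x.2.2))

/-- `H(V^k | Y₁ⁿ,…,Y_Lⁿ, Z^k)` of the induced distribution. -/
def condEntV (P : (((l : Fin L) → U l) × V × Z) → ℝ)
    (Ch : (l : Fin L) → X l → Y l → ℝ) (k n : ℕ)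
    (f : (l : Fin L) → (Fin k → U l) → (Fin n → X l) → ℝ) : ℝ :=
  condEntropy (fun x : (Fin k → V) × (((l : Fin L) → Fin n → Y l) × (Fin k → Z)) =>
    inducedDist P Ch k n f (x.2.1, x.1, x.2.2))

/-- Probability of correct decoding in the `L`-helper JSCC problem. -/
def probCorrect (P : (((l : Fin L) → U l) × V × Z) → ℝ)
    (Ch : (l : Fin L) → X l → Y l → ℝ) (k n m : ℕ)
    (f : (l : Fin L) → (Fin k → U l) → (Fin n → X l) → ℝ)
    (φ : (Fin k → V) → Fin m)
    (g : Fin m × ((l : Fin L) → Fin n → Y l) × (Fin k → Z) → (Fin k → V)) : ℝ :=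
  ∑ w : ((l : Fin L) → Fin n → Y l) × (Fin k → V) × (Fin k → Z),
    ind (g (φ w.2.1, w.1, w.2.2) = w.2.1) * inducedDist P Ch k n f w

/-- Achievability of rate `R` in the `L`-helper JSCC problem with bandwidth ratio `τ`. -/
def JSCCAchievable (P : (((l : Fin L) → U l) × V × Z) → ℝ)
    (Ch : (l : Fin L) → X l → Y l → ℝ) (τ R : ℝ) : Prop :=
  ∀ lam : ℝ, 0 < lam → lam ≤ 1 →
    ∃ (nseq mseq : ℕ → ℕ) (δ : ℕ → ℝ)
      (f : (k : ℕ) → (l : Fin L) → (Fin k → U l) → (Fin (nseq k) → X l) → ℝ)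
      (φ : (k : ℕ) → (Fin k → V) → Fin (mseq k))
      (g : (k : ℕ) → Fin (mseq k) × ((l : Fin L) → Fin (nseq k) → Y l) × (Fin k → Z) →
        (Fin k → V)),
      (∀ k, 0 ≤ δ k) ∧ Filter.Tendsto δ Filter.atTop (nhds 0) ∧
      ∀ k : ℕ, 1 ≤ k →
        (nseq k : ℝ) ≤ τ * k ∧ 1 ≤ mseq k ∧ (∀ l, IsKernel (f k l)) ∧
        1 - lam ≤ probCorrect P Ch k (nseq k) (mseq k) (f k) (φ k) (g k) ∧
        Real.logb 2 (mseq k) / k ≤ R + δ k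

/-- Optimal rate `R(τ)` of the `L`-helper JSCC problem. -/
def Rjscc (P : (((l : Fin L) → U l) × V × Z) → ℝ)
    (Ch : (l : Fin L) → X l → Y l → ℝ) (τ : ℝ) : ℝ :=
  sInf {R | JSCCAchievable P Ch τ R}

/-- `R_k`: infimum of `H(V^k|Y^n,Z^k)/k` over block lengths `n ≤ τk` and encoders. -/
def Rk (P : (((l : Fin L) → U l) × V × Z) → ℝ)
    (Ch : (l : Fin L) → X l → Y l → ℝ) (τ : ℝ) (k : ℕ) : ℝ :=
  sInf {r | ∃ n : ℕ, (n : ℝ) ≤ τ * k ∧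
    ∃ f : (l : Fin L) → (Fin k → U l) → (Fin n → X l) → ℝ,
      (∀ l, IsKernel (f l)) ∧ r = condEntV P Ch k n f / k}

end System

section SingleObserver

variable {Uu Xx Yy V Z : Type}
variable [Fintype Uu] [Fintype Xx] [Fintype Yy] [Fintype V] [Fintype Z]

/-- Single-observer induced joint pmf of `(Yⁿ, V^k, Z^k)`. -/
def inducedDist1 (R : Uu × V × Z → ℝ) (Ch : Xx → Yy → ℝ) (k n : ℕ)
    (f : (Fin k → Uu) → (Fin n → Xx) → ℝ) :
    ((Fin n → Yy) × (Fin k → V) × (Fin k → Z)) → ℝ :=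
  fun yvz => ∑ u : Fin k → Uu, ∑ x : Fin n → Xx,
    (∏ i : Fin k, R (u i, yvz.2.1 i, yvz.2.2 i)) *
      (f u x * ∏ j : Fin n, Ch (x j) (yvz.1 j))

end SingleObserver

section Aux

variable {Uu V Z Wt : Type} [Fintype Uu] [Fintype V] [Fintype Z] [Fintype Wt]

/-- Markov chain `(Z,V) − U − W` for a joint pmf on `(U × V × Z) × W`. -/
def MarkovZVUW (J : (Uu × V × Z) × Wt → ℝ) : Prop :=
  MarkovChain (fun x : (Z × V) × Uu × Wt => J ((x.2.1, x.1.2, x.1.1), x.2.2))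

/-- `I(U;W|Z)` for a joint pmf on `(U × V × Z) × W`. -/
def miUW_Z (J : (Uu × V × Z) × Wt → ℝ) : ℝ :=
  condMI (fun x : Uu × Wt × Z => ∑ v, J ((x.1, v, x.2.2), x.2.1))

/-- `I(V;W|Z)` for a joint pmf on `(U × V × Z) × W`. -/
def miVW_Z (J : (Uu × V × Z) × Wt → ℝ) : ℝ :=
  condMI (fun x : V × Wt × Z => ∑ u, J ((u, x.1, x.2.2), x.2.1))

/-- `I(U;W|V,Z)` for a joint pmf on `(U × V × Z) × W`. -/
def miUW_VZ (J : (Uu × V × Z) × Wt → ℝ) : ℝ :=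
  condMI (fun x : Uu × Wt × (V × Z) => J ((x.1, x.2.2.1, x.2.2.2), x.2.1))

/-- `H(V|W,Z)` for a joint pmf on `(U × V × Z) × W`. -/
def entV_WZ (J : (Uu × V × Z) × Wt → ℝ) : ℝ :=
  condEntropy (fun x : V × (Wt × Z) => ∑ u, J ((u, x.1, x.2.2), x.2.1))

/-- `H(V|Z)` for a joint pmf on `U × V × Z`. -/
def entV_Z (P : Uu × V × Z → ℝ) : ℝ :=
  condEntropy (fun x : V × Z => ∑ u, P (u, x.1, x.2))

end Aux

end DHT

open DHT Filter Real

namespace DHT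

lemma ind_of_true {p : Prop} (h : p) : ind p = 1 := by simp [ind, h]

lemma ind_of_false {p : Prop} (h : ¬p) : ind p = 0 := by simp [ind, h]

lemma ind_nonneg (p : Prop) : 0 ≤ ind p := by
  by_cases h : p
  · simp [ind_of_true h]
  · simp [ind_of_false h]

section FinitePMF

variable {α β : Type*} [Fintype α] [Fintype β]

lemma probIn_univ {p : α → ℝ} (hp : IsPMF p) : probIn p Set.univ = 1 := by
  simp [probIn, ind_of_true, hp.2]

lemma probIn_compl_univ (p : α → ℝ) : probIn p Set.univᶜ = 0 := by
  simp [probIn, ind_of_false]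

lemma probIn_nonneg {p : α → ℝ} (hp : IsPMF p) (A : Set α) : 0 ≤ probIn p A :=
  Finset.sum_nonneg fun a _ => mul_nonneg (ind_nonneg _) (hp.1 a)

lemma probIn_add_compl {p : α → ℝ} (hp : IsPMF p) (A : Set α) :
    probIn p A + probIn p Aᶜ = 1 := by
  rw [probIn, probIn, ← Finset.sum_add_distrib, ← hp.2]
  refine Finset.sum_congr rfl fun a _ => ?_
  by_cases h : a ∈ A
  · rw [ind_of_true h, ind_of_false (by simpa using h)]; ring
  · rw [ind_of_false h, ind_of_true (by simpa using h)]; ring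

/-- A positive pmf dominates every pmf up to a constant. -/
lemma exists_le_mul {p q : α → ℝ} (hp : IsPMF p) (hq : ∀ a, 0 < q a) :
    ∃ c : ℝ, 1 ≤ c ∧ ∀ a, p a ≤ c * q a := by
  have hnn : ∀ a ∈ Finset.univ, 0 ≤ (q a)⁻¹ := fun a _ => (inv_pos.2 (hq a)).le
  refine ⟨1 + ∑ a, (q a)⁻¹, by linarith [Finset.sum_nonneg hnn], fun a => ?_⟩
  have h1 : p a ≤ 1 := hp.2 ▸ Finset.single_le_sum (fun b _ => hp.1 b) (Finset.mem_univ a)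
  have h2 : (q a)⁻¹ ≤ ∑ a, (q a)⁻¹ := Finset.single_le_sum hnn (Finset.mem_univ a)
  calc p a ≤ 1 := h1
    _ = (q a)⁻¹ * q a := (inv_mul_cancel₀ (hq a).ne').symm
    _ ≤ (1 + ∑ a, (q a)⁻¹) * q a := mul_le_mul_of_nonneg_right (by linarith) (hq a).le

lemma probIn_le_mul {p q : α → ℝ} {c : ℝ} (h : ∀ a, p a ≤ c * q a) (A : Set α) :
    probIn p A ≤ c * probIn q A := by
  rw [probIn, probIn, Finset.mul_sum]
  refine Finset.sum_le_sum fun a _ => ?_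
  calc ind (a ∈ A) * p a ≤ ind (a ∈ A) * (c * q a) :=
        mul_le_mul_of_nonneg_left (h a) (ind_nonneg _)
    _ = c * (ind (a ∈ A) * q a) := by ring

/-- A pointwise bound on the likelihood ratio bounds the divergence. -/
lemma klDiv_le {p q : α → ℝ} (hp : IsPMF p) {c : ℝ} (hc : 0 < c)
    (h : ∀ a, p a ≤ c * q a) : klDiv p q ≤ Real.logb 2 c := by
  calc klDiv p q ≤ ∑ a, p a * Real.logb 2 c := by
        refine Finset.sum_le_sum fun a _ => ?_
        rcases (hp.1 a).eq_or_lt with h0 | h0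
        · simp [← h0]
        · have hq : 0 < q a := pos_of_mul_pos_right (h0.trans_le (h a)) hc.le
          refine mul_le_mul_of_nonneg_left ?_ h0.le
          exact Real.logb_le_logb_of_le (by norm_num) (by positivity)
            ((div_le_iff₀ hq).2 (h a))
    _ = Real.logb 2 c := by rw [← Finset.sum_mul, hp.2, one_mul]

/-- Variational (Donsker–Varadhan) lower bound on the divergence. -/
lemma sum_mul_logb_le_klDiv {p q s : α → ℝ} (hp : IsPMF p) (hq : ∀ a, 0 ≤ q a)
    (hpq : ∀ a, p a ≠ 0 → q a ≠ 0) (hs : ∀ a, 0 < s a) (hqs : ∑ a, q a * s a ≤ 1) :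
    ∑ a, p a * Real.logb 2 (s a) ≤ klDiv p q := by
  have hl : 0 < Real.log 2 := Real.log_pos (by norm_num)
  have key : ∀ a, p a * Real.logb 2 (s a) - p a * Real.logb 2 (p a / q a) ≤
      (q a * s a - p a) / Real.log 2 := by
    intro a
    rcases (hp.1 a).eq_or_lt with h0 | h0
    · simp only [← h0, zero_mul, sub_zero]
      have := hq a
      have := hs a
      positivity
    · have hqa : 0 < q a := (hq a).lt_of_ne' (hpq a h0.ne')
      have hsa := hs a
      have h1 := Real.log_le_sub_one_of_pos (show 0 < s a / (p a / q a) by positivity)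
      rw [Real.log_div hsa.ne' (by positivity)] at h1
      rw [Real.logb, Real.logb, ← mul_sub, ← sub_div, mul_div_assoc']
      refine div_le_div_of_nonneg_right ?_ hl.le
      calc p a * (Real.log (s a) - Real.log (p a / q a))
          ≤ p a * (s a / (p a / q a) - 1) := mul_le_mul_of_nonneg_left h1 h0.le
        _ = q a * s a - p a := by field_simp
  have hsum := Finset.sum_le_sum fun a (_ : a ∈ Finset.univ) => key a
  rw [Finset.sum_sub_distrib, ← Finset.sum_div, Finset.sum_sub_distrib, hp.2] at hsum
  have : (∑ a, q a * s a - 1) / Real.log 2 ≤ 0 :=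
    div_nonpos_of_nonpos_of_nonneg (by linarith) hl.le
  rw [klDiv]
  linarith

/-- Weak converse for a binary test between `p` and `q`. -/
lemma neg_probIn_mul_logb_le {p q : α → ℝ} (hp : IsPMF p) (hq : IsPMF q)
    (hpq : ∀ a, p a ≠ 0 → q a ≠ 0) {A : Set α} (hA : 0 < probIn q A) :
    -(probIn p A * Real.logb 2 (probIn q A)) - 1 ≤ klDiv p q := by
  classical
  set b := probIn q A with hb
  have hs : ∀ a, 0 < (if a ∈ A then (2 * b)⁻¹ else (2 : ℝ)⁻¹) := by
    intro a; split_ifs <;> positivity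
  refine le_trans (le_of_eq ?_) (sum_mul_logb_le_klDiv hp hq.1 hpq hs ?_)
  · have : ∀ a, p a * Real.logb 2 (if a ∈ A then (2 * b)⁻¹ else (2 : ℝ)⁻¹) =
        -(ind (a ∈ A) * p a * Real.logb 2 b) - p a := by
      intro a
      split_ifs with h
      · rw [ind_of_true h, Real.logb_inv, Real.logb_mul (by norm_num) hA.ne',
          Real.logb_self_eq_one (by norm_num)]
        ring
      · rw [ind_of_false h, Real.logb_inv, Real.logb_self_eq_one (by norm_num)]
        ring
    rw [Finset.sum_congr rfl fun a _ => this a, Finset.sum_sub_distrib, hp.2,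
      Finset.sum_neg_distrib, ← Finset.sum_mul]
    rfl
  · have hle : ∀ a, q a * (if a ∈ A then (2 * b)⁻¹ else (2 : ℝ)⁻¹) ≤
        ind (a ∈ A) * q a * (2 * b)⁻¹ + q a * 2⁻¹ := by
      intro a
      have := hq.1 a
      split_ifs with h
      · rw [ind_of_true h]; linarith
      · rw [ind_of_false h]; linarith
    refine (Finset.sum_le_sum fun a _ => hle a).trans ?_
    rw [Finset.sum_add_distrib, ← Finset.sum_mul, ← Finset.sum_mul, hq.2]
    change b * (2 * b)⁻¹ + 1 * 2⁻¹ ≤ 1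
    have : b * (2 * b)⁻¹ = 2⁻¹ := by field_simp
    rw [this]; norm_num

/-- `T` is a centred statistic under `p` with second moment at most `v`, and the expectation of
`2 ^ T` under `q`, restricted to the support of `p`, is at most `c`. -/
structure IsTestStat (p q T : α → ℝ) (v c : ℝ) : Prop where
  mean : ∑ a, p a * T a = 0
  second : ∑ a, p a * T a ^ 2 ≤ v
  expMoment : ∑ a, ind (p a ≠ 0) * (q a * (2 : ℝ) ^ T a) ≤ c

lemma IsTestStat.zero {p q : α → ℝ} (hq : IsPMF q) : IsTestStat p q (fun _ => 0) 0 1 where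
  mean := by simp
  second := by simp
  expMoment := by
    rw [← hq.2]
    refine Finset.sum_le_sum fun a _ => ?_
    by_cases h : p a ≠ 0
    · simp [ind_of_true h]
    · simp [ind_of_false h, hq.1 a]

/-- The centred log-likelihood ratio is a test statistic. -/
lemma IsTestStat.logLikelihood {p q : α → ℝ} (hp : IsPMF p) (hpq : ∀ a, p a ≠ 0 → 0 < q a) :
    IsTestStat p q (fun a => Real.logb 2 (p a / q a) - klDiv p q)
      (∑ a, p a * (Real.logb 2 (p a / q a) - klDiv p q) ^ 2) (2 ^ (-klDiv p q)) where
  mean := by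
    simp only [mul_sub, Finset.sum_sub_distrib, ← Finset.sum_mul, hp.2]
    simp [klDiv]
  second := le_rfl
  expMoment := by
    have : ∀ a, ind (p a ≠ 0) * (q a * (2 : ℝ) ^ (Real.logb 2 (p a / q a) - klDiv p q)) =
        p a * 2 ^ (-klDiv p q) := by
      intro a
      by_cases h : p a = 0
      · simp [h, ind_of_false]
      · have hqa := hpq a h
        have hpa : 0 < p a := (hp.1 a).lt_of_ne' h
        rw [ind_of_true h, sub_eq_add_neg, Real.rpow_add (by norm_num),
          Real.rpow_logb (by norm_num) (by norm_num) (by positivity)]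
        field_simp
    rw [Finset.sum_congr rfl fun a _ => this a, ← Finset.sum_mul, hp.2, one_mul]

lemma IsTestStat.prod {p₁ q₁ T₁ : α → ℝ} {p₂ q₂ T₂ : β → ℝ} {v₁ v₂ c₁ c₂ : ℝ}
    (hp₁ : IsPMF p₁) (hp₂ : IsPMF p₂) (hq₂ : ∀ b, 0 ≤ q₂ b) (hc₁ : 0 ≤ c₁)
    (h₁ : IsTestStat p₁ q₁ T₁ v₁ c₁) (h₂ : IsTestStat p₂ q₂ T₂ v₂ c₂) :
    IsTestStat (fun x : α × β => p₁ x.1 * p₂ x.2) (fun x => q₁ x.1 * q₂ x.2)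
      (fun x => T₁ x.1 + T₂ x.2) (v₁ + v₂) (c₁ * c₂) where
  mean := by
    have : ∀ x : α × β, p₁ x.1 * p₂ x.2 * (T₁ x.1 + T₂ x.2) =
        (p₁ x.1 * T₁ x.1) * p₂ x.2 + p₁ x.1 * (p₂ x.2 * T₂ x.2) := fun x => by ring
    simp only [this, Finset.sum_add_distrib, Fintype.sum_prod_type, ← Finset.sum_mul_sum,
      h₁.mean, h₂.mean]
    simp
  second := by
    have : ∀ x : α × β, p₁ x.1 * p₂ x.2 * (T₁ x.1 + T₂ x.2) ^ 2 =
        (p₁ x.1 * T₁ x.1 ^ 2) * p₂ x.2 + p₁ x.1 * (p₂ x.2 * T₂ x.2 ^ 2) +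
          (p₁ x.1 * T₁ x.1) * (2 * (p₂ x.2 * T₂ x.2)) := fun x => by ring
    simp only [this, Finset.sum_add_distrib, Fintype.sum_prod_type, ← Finset.sum_mul_sum,
      h₁.mean, hp₁.2, hp₂.2]
    linarith [h₁.second, h₂.second]
  expMoment := by
    have : ∀ x : α × β, ind (p₁ x.1 * p₂ x.2 ≠ 0) *
        (q₁ x.1 * q₂ x.2 * (2 : ℝ) ^ (T₁ x.1 + T₂ x.2)) =
        (ind (p₁ x.1 ≠ 0) * (q₁ x.1 * (2 : ℝ) ^ T₁ x.1)) *
          (ind (p₂ x.2 ≠ 0) * (q₂ x.2 * (2 : ℝ) ^ T₂ x.2)) := by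
      intro x
      rw [Real.rpow_add (by norm_num)]
      by_cases h1 : p₁ x.1 = 0
      · simp [h1, ind_of_false]
      by_cases h2 : p₂ x.2 = 0
      · simp [h2, ind_of_false]
      rw [ind_of_true (mul_ne_zero h1 h2), ind_of_true h1, ind_of_true h2]
      ring
    simp only [this, Fintype.sum_prod_type, ← Finset.sum_mul_sum]
    refine mul_le_mul h₁.expMoment h₂.expMoment ?_ hc₁
    exact Finset.sum_nonneg fun b _ => mul_nonneg (ind_nonneg _)
      (mul_nonneg (hq₂ b) (by positivity))

lemma IsTestStat.comp_equiv {p q T : β → ℝ} {v c : ℝ} (e : β ≃ α) {p' q' : α → ℝ}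
    (hp : ∀ b, p' (e b) = p b) (hq : ∀ b, q' (e b) = q b) (h : IsTestStat p q T v c) :
    IsTestStat p' q' (fun a => T (e.symm a)) v c where
  mean := by rw [← e.sum_comp]; simpa [hp] using h.mean
  second := by rw [← e.sum_comp]; simpa [hp] using h.second
  expMoment := by rw [← e.sum_comp]; simpa [hp, hq] using h.expMoment

/-- A test statistic yields a test with controlled errors of both types. -/
lemma IsTestStat.exists_test {p q T : α → ℝ} {v c t : ℝ} (hp : ∀ a, 0 ≤ p a)
    (hq : ∀ a, 0 ≤ q a) (h : IsTestStat p q T v c) (ht : 0 < t) :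
    ∃ A : Set α, probIn p Aᶜ ≤ v / t ^ 2 ∧ probIn q A ≤ 2 ^ t * c := by
  refine ⟨{a | p a ≠ 0 ∧ -t ≤ T a}, ?_, ?_⟩
  · rw [le_div_iff₀ (by positivity), probIn, Finset.sum_mul]
    refine (Finset.sum_le_sum fun a _ => ?_).trans h.second
    by_cases ha : a ∈ ({a | p a ≠ 0 ∧ -t ≤ T a} : Set α)ᶜ
    · rw [ind_of_true ha, one_mul]
      by_cases h0 : p a = 0
      · simp [h0]
      · have hT : T a < -t := by
          by_contra hcon
          exact ha ⟨h0, not_lt.1 hcon⟩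
        exact mul_le_mul_of_nonneg_left (by nlinarith) (hp a)
    · rw [ind_of_false ha, zero_mul, zero_mul]
      exact mul_nonneg (hp a) (sq_nonneg _)
  · refine le_trans ?_ (mul_le_mul_of_nonneg_left h.expMoment (by positivity))
    rw [probIn, Finset.mul_sum]
    refine Finset.sum_le_sum fun a _ => ?_
    by_cases ha : a ∈ ({a | p a ≠ 0 ∧ -t ≤ T a} : Set α)
    · rw [ind_of_true ha, ind_of_true ha.1, one_mul, one_mul]
      have h1 : (1 : ℝ) ≤ 2 ^ t * 2 ^ T a := by
        rw [← Real.rpow_add (by norm_num)]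
        exact Real.one_le_rpow (by norm_num) (by linarith [ha.2])
      nlinarith [hq a]
    · rw [ind_of_false ha, zero_mul]
      have := hq a
      have := ind_nonneg (p a ≠ 0)
      positivity

end FinitePMF

section Concatenation

variable {L : ℕ}

/-- Concatenation of `L`-tuples of finite sequences. -/
def piAppendEquiv (Y : Fin L → Type) (a b : ℕ) :
    (((l : Fin L) → Fin a → Y l) × ((l : Fin L) → Fin b → Y l)) ≃
      ((l : Fin L) → Fin (a + b) → Y l) where
  toFun y l := Fin.append (y.1 l) (y.2 l)
  invFun y := (fun l j => y l (Fin.castAdd b j), fun l j => y l (Fin.natAdd a j))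
  left_inv y := by ext <;> simp
  right_inv y := by
    funext l j
    refine Fin.addCases (fun i => ?_) (fun i => ?_) j <;> simp

variable {U X Y : Fin L → Type} {V Z : Type}

/-- Concatenation of two observation blocks. -/
def obsAppendEquiv (Y : Fin L → Type) (V Z : Type) (k₁ k₂ n₁ n₂ : ℕ) :
    ((((l : Fin L) → Fin n₁ → Y l) × (Fin k₁ → V) × (Fin k₁ → Z)) ×
      (((l : Fin L) → Fin n₂ → Y l) × (Fin k₂ → V) × (Fin k₂ → Z))) ≃
      (((l : Fin L) → Fin (n₁ + n₂) → Y l) × (Fin (k₁ + k₂) → V) × (Fin (k₁ + k₂) → Z)) where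
  toFun w := (piAppendEquiv Y n₁ n₂ (w.1.1, w.2.1), Fin.append w.1.2.1 w.2.2.1,
    Fin.append w.1.2.2 w.2.2.2)
  invFun w := ((((piAppendEquiv Y n₁ n₂).symm w.1).1, fun i => w.2.1 (Fin.castAdd k₂ i),
      fun i => w.2.2 (Fin.castAdd k₂ i)),
    (((piAppendEquiv Y n₁ n₂).symm w.1).2, fun i => w.2.1 (Fin.natAdd k₁ i),
      fun i => w.2.2 (Fin.natAdd k₁ i)))
  left_inv w := by simp
  right_inv w := by
    refine Prod.ext (by simp) (Prod.ext ?_ ?_) <;> funext j <;>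
      refine Fin.addCases (fun i => ?_) (fun i => ?_) j <;> simp

/-- The encoders acting blockwise on two consecutive blocks. -/
def encAppend {k₁ k₂ n₁ n₂ : ℕ} (f₁ : (l : Fin L) → (Fin k₁ → U l) → (Fin n₁ → X l) → ℝ)
    (f₂ : (l : Fin L) → (Fin k₂ → U l) → (Fin n₂ → X l) → ℝ) :
    (l : Fin L) → (Fin (k₁ + k₂) → U l) → (Fin (n₁ + n₂) → X l) → ℝ :=
  fun l u x => f₁ l (fun i => u (Fin.castAdd k₂ i)) (fun j => x (Fin.castAdd n₂ j)) *
    f₂ l (fun i => u (Fin.natAdd k₁ i)) (fun j => x (Fin.natAdd n₁ j))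

lemma isKernel_encAppend [∀ l, Fintype (X l)] {k₁ k₂ n₁ n₂ : ℕ}
    {f₁ : (l : Fin L) → (Fin k₁ → U l) → (Fin n₁ → X l) → ℝ}
    {f₂ : (l : Fin L) → (Fin k₂ → U l) → (Fin n₂ → X l) → ℝ}
    (h₁ : ∀ l, IsKernel (f₁ l)) (h₂ : ∀ l, IsKernel (f₂ l)) (l : Fin L) :
    IsKernel (encAppend f₁ f₂ l) := by
  intro u
  refine ⟨fun x => mul_nonneg ((h₁ l _).1 _) ((h₂ l _).1 _), ?_⟩
  rw [← (Fin.appendEquiv n₁ n₂).sum_comp]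
  simp only [encAppend, Fin.appendEquiv, Equiv.coe_fn_mk, Fin.append_left, Fin.append_right,
    Fintype.sum_prod_type, ← Finset.sum_mul_sum]
  rw [(h₁ l _).2, (h₂ l _).2, one_mul]

lemma inducedDist_encAppend [∀ l, Fintype (U l)] [∀ l, Fintype (X l)]
    (R : (((l : Fin L) → U l) × V × Z) → ℝ)
    (Ch : (l : Fin L) → X l → Y l → ℝ) {k₁ k₂ n₁ n₂ : ℕ}
    (f₁ : (l : Fin L) → (Fin k₁ → U l) → (Fin n₁ → X l) → ℝ)
    (f₂ : (l : Fin L) → (Fin k₂ → U l) → (Fin n₂ → X l) → ℝ)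
    (w : ((((l : Fin L) → Fin n₁ → Y l) × (Fin k₁ → V) × (Fin k₁ → Z)) ×
      (((l : Fin L) → Fin n₂ → Y l) × (Fin k₂ → V) × (Fin k₂ → Z)))) :
    inducedDist R Ch (k₁ + k₂) (n₁ + n₂) (encAppend f₁ f₂)
        (obsAppendEquiv Y V Z k₁ k₂ n₁ n₂ w) =
      inducedDist R Ch k₁ n₁ f₁ w.1 * inducedDist R Ch k₂ n₂ f₂ w.2 := by
  unfold inducedDist
  rw [← (piAppendEquiv U k₁ k₂).sum_comp, Fintype.sum_prod_type]
  simp only [Finset.sum_mul_sum]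
  refine Finset.sum_congr rfl fun u₁ _ => Finset.sum_congr rfl fun u₂ _ => ?_
  rw [← (piAppendEquiv X n₁ n₂).sum_comp, Fintype.sum_prod_type]
  refine Finset.sum_congr rfl fun x₁ _ => Finset.sum_congr rfl fun x₂ _ => ?_
  simp only [obsAppendEquiv, piAppendEquiv, encAppend, Equiv.coe_fn_mk, Fin.prod_univ_add,
    Fin.append_left, Fin.append_right, Finset.prod_mul_distrib]
  ring

lemma inducedDist_nonneg [∀ l, Fintype (U l)] [∀ l, Fintype (X l)] [∀ l, Fintype (Y l)]
    {R : (((l : Fin L) → U l) × V × Z) → ℝ} (hR : ∀ x, 0 ≤ R x)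
    {Ch : (l : Fin L) → X l → Y l → ℝ} (hCh : ∀ l, IsKernel (Ch l)) {k n : ℕ}
    {f : (l : Fin L) → (Fin k → U l) → (Fin n → X l) → ℝ} (hf : ∀ l, IsKernel (f l)) (w) :
    0 ≤ inducedDist R Ch k n f w :=
  Finset.sum_nonneg fun _ _ => Finset.sum_nonneg fun _ _ =>
    mul_nonneg (Finset.prod_nonneg fun _ _ => hR _)
      (mul_nonneg (Finset.prod_nonneg fun l _ => (hf l _).1 _)
        (Finset.prod_nonneg fun l _ => Finset.prod_nonneg fun _ _ => (hCh l _).1 _))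

lemma inducedDist_le_pow_mul [∀ l, Fintype (U l)] [∀ l, Fintype (X l)] [∀ l, Fintype (Y l)]
    {P Q : (((l : Fin L) → U l) × V × Z) → ℝ} (hP : ∀ x, 0 ≤ P x)
    {c : ℝ} (hc : ∀ x, P x ≤ c * Q x)
    {Ch : (l : Fin L) → X l → Y l → ℝ} (hCh : ∀ l, IsKernel (Ch l)) {k n : ℕ}
    {f : (l : Fin L) → (Fin k → U l) → (Fin n → X l) → ℝ} (hf : ∀ l, IsKernel (f l)) (w) :
    inducedDist P Ch k n f w ≤ c ^ k * inducedDist Q Ch k n f w := by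
  unfold inducedDist
  simp only [Finset.mul_sum]
  refine Finset.sum_le_sum fun u _ => Finset.sum_le_sum fun x _ => ?_
  rw [← mul_assoc (c ^ k)]
  refine mul_le_mul_of_nonneg_right ?_
    (mul_nonneg (Finset.prod_nonneg fun l _ => (hf l _).1 _)
        (Finset.prod_nonneg fun l _ => Finset.prod_nonneg fun _ _ => (hCh l _).1 _))
  calc _ ≤ ∏ i : Fin k, c * Q ((fun l => u l i), w.2.1 i, w.2.2 i) :=
        Finset.prod_le_prod (fun _ _ => hP _) fun _ _ => hc _
    _ = _ := by rw [Finset.prod_mul_distrib]; simp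

lemma isKernel_empty_block {α : Type*} {X : Type} [Fintype X] :
    IsKernel (fun (_ : α) (_ : Fin 0 → X) => (1 : ℝ)) :=
  fun _ => ⟨fun _ => zero_le_one, by simp⟩

lemma exists_encoder [∀ l, Fintype (X l)] {τ : ℝ} (hτ : 0 < τ) (k : ℕ) : ∃ n : ℕ, (n : ℝ) ≤ τ * k ∧
    ∃ f : (l : Fin L) → (Fin k → U l) → (Fin n → X l) → ℝ, ∀ l, IsKernel (f l) :=
  ⟨0, by simpa using mul_nonneg hτ.le (Nat.cast_nonneg k), fun _ _ _ => 1,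
    fun _ => isKernel_empty_block⟩

end Concatenation

section Induced

variable {L : ℕ} {U X Y : Fin L → Type} {V Z : Type}
variable [∀ l, Fintype (U l)] [∀ l, Fintype (X l)] [∀ l, Fintype (Y l)]
variable [Fintype V] [Fintype Z]

/-- Sequences of source symbols as tuples of component sequences. -/
def sourceSeqEquiv (U : Fin L → Type) (V Z : Type) (k : ℕ) :
    (Fin k → ((l : Fin L) → U l) × V × Z) ≃
      (((l : Fin L) → Fin k → U l) × (Fin k → V) × (Fin k → Z)) where
  toFun s := (fun l i => (s i).1 l, fun i => (s i).2.1, fun i => (s i).2.2)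
  invFun w i := (fun l => w.1 l i, w.2.1 i, w.2.2 i)
  left_inv _ := rfl
  right_inv _ := rfl

lemma isPMF_inducedDist {R : (((l : Fin L) → U l) × V × Z) → ℝ} (hR : IsPMF R)
    {Ch : (l : Fin L) → X l → Y l → ℝ} (hCh : ∀ l, IsKernel (Ch l)) {k n : ℕ}
    {f : (l : Fin L) → (Fin k → U l) → (Fin n → X l) → ℝ} (hf : ∀ l, IsKernel (f l)) :
    IsPMF (inducedDist R Ch k n f) := by
  classical
  refine ⟨inducedDist_nonneg hR.1 hCh hf, ?_⟩
  have hchan : ∀ x : (l : Fin L) → Fin n → X l,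
      ∑ y : (l : Fin L) → Fin n → Y l, ∏ l, ∏ j, Ch l (x l j) (y l j) = 1 := by
    intro x
    rw [← Fintype.prod_sum (fun l (y : Fin n → Y l) => ∏ j, Ch l (x l j) (y j))]
    refine Finset.prod_eq_one fun l _ => ?_
    rw [← Fintype.prod_sum (fun j (y : Y l) => Ch l (x l j) y)]
    exact Finset.prod_eq_one fun j _ => (hCh l _).2
  have henc : ∀ u : (l : Fin L) → Fin k → U l,
      ∑ x : (l : Fin L) → Fin n → X l, ∏ l, f l (u l) (x l) = 1 := by
    intro u
    rw [← Fintype.prod_sum (fun l (x : Fin n → X l) => f l (u l) x)]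
    exact Finset.prod_eq_one fun l _ => (hf l _).2
  have hsrc : ∑ w : ((l : Fin L) → Fin k → U l) × (Fin k → V) × (Fin k → Z),
      ∏ i, R ((fun l => w.1 l i), w.2.1 i, w.2.2 i) = 1 := by
    rw [← (sourceSeqEquiv U V Z k).sum_comp]
    change ∑ s : Fin k → ((l : Fin L) → U l) × V × Z, ∏ i, R (s i) = 1
    rw [← Fintype.prod_sum (fun (_ : Fin k) s => R s)]
    exact Finset.prod_eq_one fun _ _ => hR.2
  have hvz : ∀ vz : (Fin k → V) × (Fin k → Z),
      ∑ y : (l : Fin L) → Fin n → Y l, inducedDist R Ch k n f (y, vz) =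
        ∑ u : (l : Fin L) → Fin k → U l, ∏ i, R ((fun l => u l i), vz.1 i, vz.2 i) := by
    intro vz
    unfold inducedDist
    rw [Finset.sum_comm]
    refine Finset.sum_congr rfl fun u _ => ?_
    rw [Finset.sum_comm]
    simp only [← Finset.mul_sum, hchan, mul_one, henc]
  rw [Fintype.sum_prod_type_right, Finset.sum_congr rfl fun vz _ => hvz vz,
    ← Fintype.sum_prod_type_right
      (fun w : ((l : Fin L) → Fin k → U l) × (Fin k → V) × (Fin k → Z) =>
        ∏ i, R ((fun l => w.1 l i), w.2.1 i, w.2.2 i))]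
  exact hsrc

/-- Repeating an encoder on `m` blocks (and ignoring `r` further symbols) adds up test
statistics. -/
lemma exists_isTestStat_blocks {P Q : (((l : Fin L) → U l) × V × Z) → ℝ} (hP : IsPMF P)
    (hQ : IsPMF Q) {Ch : (l : Fin L) → X l → Y l → ℝ} (hCh : ∀ l, IsKernel (Ch l)) {k₀ n₀ : ℕ}
    {f₀ : (l : Fin L) → (Fin k₀ → U l) → (Fin n₀ → X l) → ℝ} (hf₀ : ∀ l, IsKernel (f₀ l))
    {T₀ v c} (hc : 0 ≤ c)
    (hT₀ : IsTestStat (inducedDist P Ch k₀ n₀ f₀) (inducedDist Q Ch k₀ n₀ f₀) T₀ v c)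
    (m r : ℕ) : ∀ k n : ℕ, k = m * k₀ + r → n = m * n₀ →
      ∃ f : (l : Fin L) → (Fin k → U l) → (Fin n → X l) → ℝ, (∀ l, IsKernel (f l)) ∧
        ∃ T, IsTestStat (inducedDist P Ch k n f) (inducedDist Q Ch k n f) T (m * v) (c ^ m) := by
  induction m with
  | zero =>
    intro k n hk hn
    obtain rfl : n = 0 := by simpa using hn
    have hf : ∀ l, IsKernel (fun (_ : Fin k → U l) (_ : Fin 0 → X l) => (1 : ℝ)) :=
      fun l => isKernel_empty_block
    refine ⟨fun _ _ _ => 1, hf, fun _ => 0, ?_⟩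
    simpa using IsTestStat.zero (isPMF_inducedDist hQ hCh hf)
  | succ m ih =>
    intro k n hk hn
    obtain ⟨f, hf, T, hT⟩ := ih (m * k₀ + r) (m * n₀) rfl rfl
    obtain rfl : k = (m * k₀ + r) + k₀ := by rw [hk]; ring
    obtain rfl : n = m * n₀ + n₀ := by rw [hn]; ring
    have := (hT.prod (isPMF_inducedDist hP hCh hf) (isPMF_inducedDist hP hCh hf₀)
      (inducedDist_nonneg hQ.1 hCh hf₀) (by positivity) hT₀).comp_equiv
        (obsAppendEquiv Y V Z _ _ _ _) (inducedDist_encAppend P Ch f f₀)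
        (inducedDist_encAppend Q Ch f f₀)
    have e1 : ((m + 1 : ℕ) : ℝ) * v = m * v + v := by push_cast; ring
    rw [e1, pow_succ]
    exact ⟨encAppend f f₀, isKernel_encAppend hf hf₀, _, this⟩

end Induced

section Exponent

variable {L : ℕ} {U X Y : Fin L → Type} {V Z : Type}
variable [∀ l, Fintype (U l)] [∀ l, Fintype (X l)] [∀ l, Fintype (Y l)]
variable [Fintype V] [Fintype Z]
variable {P Q : (((l : Fin L) → U l) × V × Z) → ℝ} {Ch : (l : Fin L) → X l → Y l → ℝ} {τ : ℝ}

lemma klDiv_inducedDist_div_le (hP : IsPMF P) (hCh : ∀ l, IsKernel (Ch l)) {c : ℝ} (hc1 : 1 ≤ c)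
    (hc : ∀ x, P x ≤ c * Q x) {k n : ℕ}
    {f : (l : Fin L) → (Fin k → U l) → (Fin n → X l) → ℝ} (hf : ∀ l, IsKernel (f l)) :
    klDiv (inducedDist P Ch k n f) (inducedDist Q Ch k n f) / k ≤ Real.logb 2 c := by
  have hc0 : 0 < c := by linarith
  have h := klDiv_le (isPMF_inducedDist hP hCh hf) (pow_pos hc0 k)
    (inducedDist_le_pow_mul hP.1 hc hCh hf)
  rw [Real.logb_pow] at h
  exact div_le_of_le_mul₀ (Nat.cast_nonneg k) (Real.logb_nonneg (by norm_num) hc1)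
    (by linarith)

lemma klDiv_inducedDist_le_theta (hP : IsPMF P) (hQpos : ∀ x, 0 < Q x)
    (hCh : ∀ l, IsKernel (Ch l)) (hτ : 0 < τ) {k n : ℕ} (hk : 1 ≤ k) (hn : (n : ℝ) ≤ τ * k)
    {f : (l : Fin L) → (Fin k → U l) → (Fin n → X l) → ℝ} (hf : ∀ l, IsKernel (f l)) :
    klDiv (inducedDist P Ch k n f) (inducedDist Q Ch k n f) / k ≤ theta P Q Ch τ := by
  obtain ⟨c, hc1, hc⟩ := exists_le_mul hP hQpos
  have hbdd : ∀ k, thetaK P Q Ch τ k ≤ Real.logb 2 c := by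
    intro k
    obtain ⟨n, hn, f, hf⟩ := exists_encoder (L := L) (U := U) (X := X) hτ k
    refine csSup_le ⟨_, n, hn, f, hf, rfl⟩ ?_
    rintro _ ⟨n, -, f, hf, rfl⟩
    exact klDiv_inducedDist_div_le hP hCh hc1 hc hf
  calc _ ≤ thetaK P Q Ch τ k := by
        refine le_csSup ⟨Real.logb 2 c, ?_⟩ ⟨n, hn, f, hf, rfl⟩
        rintro _ ⟨n, -, f, hf, rfl⟩
        exact klDiv_inducedDist_div_le hP hCh hc1 hc hf
    _ ≤ theta P Q Ch τ := by
        refine le_csSup ⟨Real.logb 2 c, ?_⟩ ⟨k, hk, rfl⟩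
        rintro _ ⟨k, -, rfl⟩
        exact hbdd k

lemma beta_le_of_test (hQ : IsPMF Q) (hCh : ∀ l, IsKernel (Ch l)) {ε : ℝ} {k n : ℕ}
    (hn : (n : ℝ) ≤ τ * k) {f : (l : Fin L) → (Fin k → U l) → (Fin n → X l) → ℝ}
    (hf : ∀ l, IsKernel (f l))
    {A : Set (((l : Fin L) → Fin n → Y l) × (Fin k → V) × (Fin k → Z))}
    (hA : probIn (inducedDist P Ch k n f) Aᶜ ≤ ε) :
    beta P Q Ch τ ε k ≤ probIn (inducedDist Q Ch k n f) A := by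
  refine csInf_le ⟨0, ?_⟩ ⟨n, hn, f, hf, A, hA, rfl⟩
  rintro _ ⟨n, -, f, hf, A, -, rfl⟩
  exact probIn_nonneg (isPMF_inducedDist hQ hCh hf) A

lemma beta_le_one (hQ : IsPMF Q) (hCh : ∀ l, IsKernel (Ch l)) (hτ : 0 < τ) {ε : ℝ}
    (hε : 0 ≤ ε) (k : ℕ) : beta P Q Ch τ ε k ≤ 1 := by
  obtain ⟨n, hn, f, hf⟩ := exists_encoder (L := L) (U := U) (X := X) hτ k
  have h := beta_le_of_test (P := P) (ε := ε) hQ hCh hn hf (A := Set.univ)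
    (by rwa [probIn_compl_univ])
  rwa [probIn_univ (isPMF_inducedDist hQ hCh hf)] at h

/-- Weak converse: non-asymptotic lower bound on the type-2 error. -/
lemma rpow_le_beta (hP : IsPMF P) (hQ : IsPMF Q) (hQpos : ∀ x, 0 < Q x)
    (hCh : ∀ l, IsKernel (Ch l)) (hτ : 0 < τ) {ε : ℝ} (hε : 0 ≤ ε) (hε1 : ε < 1)
    {k : ℕ} (hk : 1 ≤ k) :
    (2 : ℝ) ^ (-((k * theta P Q Ch τ + 1) / (1 - ε))) ≤ beta P Q Ch τ ε k := by
  obtain ⟨c, hc1, hc⟩ := exists_le_mul hP hQpos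
  obtain ⟨n, hn, f, hf⟩ := exists_encoder (L := L) (U := U) (X := X) hτ k
  refine le_csInf ⟨_, n, hn, f, hf, Set.univ, ?_, rfl⟩ ?_
  · rwa [probIn_compl_univ]
  rintro _ ⟨n, hn, f, hf, A, hA, rfl⟩
  have hp := isPMF_inducedDist hP hCh hf
  have hq := isPMF_inducedDist hQ hCh hf
  have hle := inducedDist_le_pow_mul hP.1 hc hCh hf
  have hc0 : 0 < c ^ k := pow_pos (by linarith) k
  have hpA : 1 - ε ≤ probIn (inducedDist P Ch k n f) A := by
    linarith [probIn_add_compl hp A]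
  have hqA : 0 < probIn (inducedDist Q Ch k n f) A :=
    pos_of_mul_pos_right ((show 0 < 1 - ε by linarith).trans_le
      (hpA.trans (probIn_le_mul hle A))) hc0.le
  have hqA1 : probIn (inducedDist Q Ch k n f) A ≤ 1 := by
    linarith [probIn_add_compl hq A, probIn_nonneg hq Aᶜ]
  have hconv := neg_probIn_mul_logb_le hp hq (fun a ha h0 => ha
    (le_antisymm (by simpa [h0] using hle a) (hp.1 a))) hqA
  have hth := klDiv_inducedDist_le_theta hP hQpos hCh hτ hk hn hf
  rw [div_le_iff₀ (by exact_mod_cast hk)] at hth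
  have hlog : Real.logb 2 (probIn (inducedDist Q Ch k n f) A) ≤ 0 :=
    Real.logb_nonpos (by norm_num) hqA.le hqA1
  rw [← Real.le_logb_iff_rpow_le (by norm_num) hqA, neg_le, le_div_iff₀ (by linarith)]
  nlinarith

lemma eventually_logb_beta_nonpos (hP : IsPMF P) (hQ : IsPMF Q) (hQpos : ∀ x, 0 < Q x)
    (hCh : ∀ l, IsKernel (Ch l)) (hτ : 0 < τ) {ε : ℝ} (hε : 0 ≤ ε) (hε1 : ε < 1) :
    ∀ᶠ k : ℕ in atTop, Real.logb 2 (beta P Q Ch τ ε k) / k ≤ 0 := by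
  filter_upwards [eventually_ge_atTop 1] with k hk
  have h0 : 0 < beta P Q Ch τ ε k :=
    (Real.rpow_pos_of_pos (by norm_num) _).trans_le
      (rpow_le_beta hP hQ hQpos hCh hτ hε hε1 hk)
  exact div_nonpos_of_nonpos_of_nonneg
    (Real.logb_nonpos (by norm_num) h0.le (beta_le_one hQ hCh hτ hε k)) (Nat.cast_nonneg k)

lemma eventually_le_logb_beta (hP : IsPMF P) (hQ : IsPMF Q) (hQpos : ∀ x, 0 < Q x)
    (hCh : ∀ l, IsKernel (Ch l)) (hτ : 0 < τ) {ε : ℝ} (hε : 0 ≤ ε) (hε1 : ε < 1) :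
    ∀ᶠ k : ℕ in atTop, -((theta P Q Ch τ + 1 / k) / (1 - ε)) ≤
      Real.logb 2 (beta P Q Ch τ ε k) / k := by
  filter_upwards [eventually_ge_atTop 1] with k hk
  have hb := rpow_le_beta hP hQ hQpos hCh hτ hε hε1 hk
  have h0 : 0 < beta P Q Ch τ ε k := (Real.rpow_pos_of_pos (by norm_num) _).trans_le hb
  have hk0 : (0 : ℝ) < k := by exact_mod_cast hk
  rw [← Real.le_logb_iff_rpow_le (by norm_num) h0] at hb
  rw [le_div_iff₀ hk0]
  refine le_trans (le_of_eq ?_) hb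
  have : 1 - ε ≠ 0 := by linarith
  field_simp

lemma tendsto_converse_bound (a ε : ℝ) :
    Tendsto (fun k : ℕ => -((a + 1 / (k : ℝ)) / (1 - ε))) atTop (nhds (-(a / (1 - ε)))) := by
  have := ((tendsto_const_nhds (x := a)).add tendsto_one_div_atTop_nhds_zero_nat).div_const
    (1 - ε)
  simpa using this.neg

lemma neg_theta_div_le_limsup (hP : IsPMF P) (hQ : IsPMF Q) (hQpos : ∀ x, 0 < Q x)
    (hCh : ∀ l, IsKernel (Ch l)) (hτ : 0 < τ) {ε : ℝ} (hε : 0 ≤ ε) (hε1 : ε < 1) :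
    -(theta P Q Ch τ / (1 - ε)) ≤
      limsup (fun k : ℕ => Real.logb 2 (beta P Q Ch τ ε k) / k) atTop := by
  have ht := tendsto_converse_bound (theta P Q Ch τ) ε
  rw [← ht.limsup_eq]
  exact limsup_le_limsup (eventually_le_logb_beta hP hQ hQpos hCh hτ hε hε1) ht.isCoboundedUnder_le
    (isBoundedUnder_of_eventually_le
      (eventually_logb_beta_nonpos hP hQ hQpos hCh hτ hε hε1))

lemma isCoboundedUnder_logb_beta (hP : IsPMF P) (hQ : IsPMF Q) (hQpos : ∀ x, 0 < Q x)
    (hCh : ∀ l, IsKernel (Ch l)) (hτ : 0 < τ) {ε : ℝ} (hε : 0 ≤ ε) (hε1 : ε < 1) :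
    IsCoboundedUnder (· ≤ ·) atTop
      (fun k : ℕ => Real.logb 2 (beta P Q Ch τ ε k) / k) := by
  have ht := tendsto_converse_bound (theta P Q Ch τ) ε
  obtain ⟨b, hb⟩ := ht.isBoundedUnder_ge
  refine IsBoundedUnder.isCoboundedUnder_le ⟨b, ?_⟩
  rw [eventually_map] at hb ⊢
  filter_upwards [hb, eventually_le_logb_beta hP hQ hQpos hCh hτ hε hε1] with k h1 h2
  exact le_trans h1 h2

/-- The optimal exponent is the negative of the limit superior in its definition. -/
lemma kappa_eq_neg_limsup (hP : IsPMF P) (hQ : IsPMF Q) (hQpos : ∀ x, 0 < Q x)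
    (hCh : ∀ l, IsKernel (Ch l)) (hτ : 0 < τ) {ε : ℝ} (hε : 0 ≤ ε) (hε1 : ε < 1) :
    kappa P Q Ch τ ε =
      -limsup (fun k : ℕ => Real.logb 2 (beta P Q Ch τ ε k) / k) atTop := by
  set s := limsup (fun k : ℕ => Real.logb 2 (beta P Q Ch τ ε k) / k) atTop with hs
  have hs0 : s ≤ 0 := limsup_le_of_le (isCoboundedUnder_logb_beta hP hQ hQpos hCh hτ hε hε1)
    (eventually_logb_beta_nonpos hP hQ hQpos hCh hτ hε hε1)
  refine IsGreatest.csSup_eq ⟨⟨by linarith, fun δ hδ => by linarith⟩, ?_⟩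
  rintro κ ⟨-, hκ⟩
  refine le_of_forall_pos_le_add fun δ hδ => ?_
  linarith [hκ δ hδ]

/-- Achievability: repeating a block code with a threshold test on the log-likelihood ratio. -/
lemma limsup_le_neg_klDiv_sub (hP : IsPMF P) (hQ : IsPMF Q) (hQpos : ∀ x, 0 < Q x)
    (hCh : ∀ l, IsKernel (Ch l)) (hτ : 0 < τ) {ε : ℝ} (hε : 0 < ε) (hε1 : ε < 1)
    {k₀ n₀ : ℕ} (hk₀ : 1 ≤ k₀) (hn₀ : (n₀ : ℝ) ≤ τ * k₀)
    {f₀ : (l : Fin L) → (Fin k₀ → U l) → (Fin n₀ → X l) → ℝ} (hf₀ : ∀ l, IsKernel (f₀ l))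
    {δ : ℝ} (hδ : 0 < δ) :
    limsup (fun k : ℕ => Real.logb 2 (beta P Q Ch τ ε k) / k) atTop ≤
      -((klDiv (inducedDist P Ch k₀ n₀ f₀) (inducedDist Q Ch k₀ n₀ f₀) - δ) / k₀) := by
  set D := klDiv (inducedDist P Ch k₀ n₀ f₀) (inducedDist Q Ch k₀ n₀ f₀) with hD
  obtain ⟨c, hc1, hc⟩ := exists_le_mul hP hQpos
  have hp := isPMF_inducedDist hP hCh hf₀
  have hq := isPMF_inducedDist hQ hCh hf₀
  have hle := inducedDist_le_pow_mul (n := n₀) hP.1 hc hCh hf₀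
  have hT := IsTestStat.logLikelihood hp (q := inducedDist Q Ch k₀ n₀ f₀) fun a ha =>
    (hq.1 a).lt_of_ne' fun h0 => ha (le_antisymm (by simpa [h0] using hle a) (hp.1 a))
  rw [← hD] at hT
  set v := ∑ a, inducedDist P Ch k₀ n₀ f₀ a *
    (Real.logb 2 (inducedDist P Ch k₀ n₀ f₀ a / inducedDist Q Ch k₀ n₀ f₀ a) - D) ^ 2 with hv
  have hk₀' : (0 : ℝ) < k₀ := by exact_mod_cast hk₀
  have hm : Tendsto (fun k : ℕ => k / k₀) atTop atTop :=
    Nat.tendsto_div_const_atTop (by omega)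
  have hvar : ∀ᶠ k : ℕ in atTop, v / δ ^ 2 / ε ≤ ((k / k₀ : ℕ) : ℝ) :=
    (tendsto_natCast_atTop_atTop.comp hm).eventually_ge_atTop _
  have hub : ∀ᶠ k : ℕ in atTop, Real.logb 2 (beta P Q Ch τ ε k) / k ≤
      -((D - δ) * (((k / k₀ : ℕ) : ℝ) / k)) := by
    filter_upwards [hvar, hm.eventually_ge_atTop 1, eventually_ge_atTop 1] with k h1 h2 h3
    have hdiv := (Nat.div_add_mod' k k₀).symm
    have hmul := Nat.div_mul_le_self k k₀
    generalize k / k₀ = m at h1 h2 hdiv hmul ⊢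
    obtain ⟨f, hf, T, hfT⟩ := exists_isTestStat_blocks hP hQ hCh hf₀ (by positivity) hT
      m (k % k₀) k (m * n₀) hdiv rfl
    have hm0 : (0 : ℝ) < m := by exact_mod_cast h2
    obtain ⟨A, hA1, hA2⟩ := hfT.exists_test (inducedDist_nonneg hP.1 hCh hf)
      (inducedDist_nonneg hQ.1 hCh hf) (t := m * δ) (by positivity)
    have hA3 : probIn (inducedDist P Ch k (m * n₀) f) Aᶜ ≤ ε := by
      refine hA1.trans ?_
      rw [div_div, div_le_iff₀ (by positivity)] at h1
      rw [div_le_iff₀ (by positivity)]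
      nlinarith
    have hn : ((m * n₀ : ℕ) : ℝ) ≤ τ * k := by
      have : (m : ℝ) * k₀ ≤ k := by exact_mod_cast hmul
      push_cast
      nlinarith
    have hb := (beta_le_of_test hQ hCh hn hf hA3).trans hA2
    have h0 : 0 < beta P Q Ch τ ε k := (Real.rpow_pos_of_pos (by norm_num) _).trans_le
      (rpow_le_beta hP hQ hQpos hCh hτ hε.le hε1 h3)
    rw [← Real.rpow_natCast, ← Real.rpow_mul (by norm_num), ← Real.rpow_add (by norm_num),
      ← Real.logb_le_iff_le_rpow (by norm_num) h0] at hb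
    have hk0 : (0 : ℝ) < k := by exact_mod_cast h3
    rw [div_le_iff₀ hk0]
    refine hb.trans (le_of_eq ?_)
    field_simp
    ring
  have hlim : Tendsto (fun k : ℕ => -((D - δ) * (((k / k₀ : ℕ) : ℝ) / k))) atTop
      (nhds (-((D - δ) / k₀))) := by
    have h1 := (tendsto_nat_floor_mul_div_atTop (R := ℝ) (a := (k₀ : ℝ)⁻¹)
      (by positivity)).comp tendsto_natCast_atTop_atTop
    have h2 : Tendsto (fun k : ℕ => ((k / k₀ : ℕ) : ℝ) / k) atTop (nhds ((k₀ : ℝ)⁻¹)) := by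
      refine h1.congr fun k => ?_
      simp only [Function.comp]
      rw [inv_mul_eq_div, Nat.floor_div_eq_div]
    exact (h2.const_mul (D - δ)).neg
  rw [← hlim.limsup_eq]
  exact limsup_le_limsup hub (isCoboundedUnder_logb_beta hP hQ hQpos hCh hτ hε.le hε1)
    hlim.isBoundedUnder_le

lemma theta_le_kappa (hP : IsPMF P) (hQ : IsPMF Q) (hQpos : ∀ x, 0 < Q x)
    (hCh : ∀ l, IsKernel (Ch l)) (hτ : 0 < τ) {ε : ℝ} (hε : 0 < ε) (hε1 : ε < 1) :
    theta P Q Ch τ ≤ kappa P Q Ch τ ε := by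
  rw [kappa_eq_neg_limsup hP hQ hQpos hCh hτ hε.le hε1]
  refine csSup_le ⟨_, 1, le_rfl, rfl⟩ ?_
  rintro _ ⟨k, hk, rfl⟩
  obtain ⟨n, hn, f, hf⟩ := exists_encoder (L := L) (U := U) (X := X) hτ k
  refine csSup_le ⟨_, n, hn, f, hf, rfl⟩ ?_
  rintro _ ⟨n, hn, f, hf, rfl⟩
  have hk0 : (0 : ℝ) < k := by exact_mod_cast hk
  refine le_of_forall_pos_le_add fun δ hδ => ?_
  have h := limsup_le_neg_klDiv_sub hP hQ hQpos hCh hτ hε hε1 hk hn hf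
    (mul_pos hδ hk0)
  rw [sub_div, mul_div_cancel_right₀ _ hk0.ne'] at h
  linarith

lemma kappa_le_theta_div (hP : IsPMF P) (hQ : IsPMF Q) (hQpos : ∀ x, 0 < Q x)
    (hCh : ∀ l, IsKernel (Ch l)) (hτ : 0 < τ) {ε : ℝ} (hε : 0 < ε) (hε1 : ε < 1) :
    kappa P Q Ch τ ε ≤ theta P Q Ch τ / (1 - ε) := by
  rw [kappa_eq_neg_limsup hP hQ hQpos hCh hτ hε.le hε1]
  linarith [neg_theta_div_le_limsup hP hQ hQpos hCh hτ hε.le hε1]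

end Exponent

end DHT

/-- For every bandwidth ratio `τ > 0`, the optimal type-2 error exponent
satisfies `lim_{ε→0} κ(τ,ε) = θ(τ)`. -/
theorem statement_2 {L : ℕ} {U X Y : Fin L → Type} {V Z : Type}
    [∀ l, Fintype (U l)] [∀ l, Fintype (X l)] [∀ l, Fintype (Y l)]
    [Fintype V] [Fintype Z]
    (P Q : (((l : Fin L) → U l) × V × Z) → ℝ)
    (hP : IsPMF P) (hQ : IsPMF Q) (hmarg : SameMarginals P Q) (hQpos : ∀ x, 0 < Q x)
    (Ch : (l : Fin L) → X l → Y l → ℝ) (hCh : ∀ l, IsKernel (Ch l))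
    (τ : ℝ) (hτ : 0 < τ) :
    Filter.Tendsto (fun ε : ℝ => kappa P Q Ch τ ε) (nhdsWithin 0 (Set.Ioi 0))
      (nhds (theta P Q Ch τ)) := by
  have hev : ∀ᶠ ε : ℝ in nhdsWithin 0 (Set.Ioi 0), 0 < ε ∧ ε < 1 :=
    Ioo_mem_nhdsGT zero_lt_one
  have hlim : Tendsto (fun ε : ℝ => theta P Q Ch τ / (1 - ε)) (nhdsWithin 0 (Set.Ioi 0))
      (nhds (theta P Q Ch τ)) := by
    have hc : ContinuousAt (fun ε : ℝ => theta P Q Ch τ / (1 - ε)) 0 :=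
      continuousAt_const.div (continuousAt_const.sub continuousAt_id) (by norm_num)
    simpa using hc.tendsto.mono_left nhdsWithin_le_nhds
  exact tendsto_of_tendsto_of_tendsto_of_le_of_le' tendsto_const_nhds hlim
    (hev.mono fun ε h => theta_le_kappa hP hQ hQpos hCh hτ h.1 h.2)
    (hev.mono fun ε h => kappa_le_theta_div hP hQ hQpos hCh hτ h.1 h.2)
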